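/- There is a universal constant a > 0 such that for every N ≥ 2 and every total Boolean function f : {0,1}^N → {0,1}, the cheat sheet version f_CS satisfies UC_1(f_CS) ≤ a · C(f) · (log₂ N)². (Note the bound is in terms of the certificate complexity C(f), not the unambiguous certificate complexity: the cheat sheet construction makes 1-certificates unambiguous.) -/

import Mathlib

/-! ### Partial assignments and certificate complexity -/

/-- An input `x` is consistent with a partial assignment `p` if it agrees with
`p` wherever `p` is defined. -/
def Consistent {n : ℕ} (x : Fin n → Bool) (p : Fin n → Option Bool) : Prop :=
  ∀ i : Fin n, ∀ b : Bool, p i = some b → x i = b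

instance {n : ℕ} (x : Fin n → Bool) (p : Fin n → Option Bool) :
    Decidable (Consistent x p) := by unfold Consistent; infer_instance

/-- The width of a partial assignment: the number of fixed coordinates. -/
def paWidth {n : ℕ} (p : Fin n → Option Bool) : ℕ :=
  (Finset.univ.filter (fun i : Fin n => (p i).isSome)).card

/-- `p` is a `b`-certificate for `f`: every input consistent with `p` has value `b`. -/
def IsCert {n : ℕ} (f : (Fin n → Bool) → Bool) (b : Bool) (p : Fin n → Option Bool) : Prop :=
  ∀ x : Fin n → Bool, Consistent x p → f x = b

instance {n : ℕ} (f : (Fin n → Bool) → Bool) (b : Bool) (p : Fin n → Option Bool) :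
    Decidable (IsCert f b p) := by unfold IsCert; infer_instance

/-- The `b`-certificate complexity `C_b(f)`. -/
noncomputable def certC {n : ℕ} (f : (Fin n → Bool) → Bool) (b : Bool) : ℕ :=
  sInf {w : ℕ | ∀ x : Fin n → Bool, f x = b →
    ∃ p : Fin n → Option Bool, IsCert f b p ∧ paWidth p ≤ w ∧ Consistent x p}

/-- The certificate complexity `C(f) = max{C_0(f), C_1(f)}`. -/
noncomputable def certCC {n : ℕ} (f : (Fin n → Bool) → Bool) : ℕ :=
  max (certC f false) (certC f true)

/-- The unambiguous `b`-certificate complexity `UC_b(f)`. -/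
noncomputable def UCb {n : ℕ} (f : (Fin n → Bool) → Bool) (b : Bool) : ℕ :=
  sInf {w : ℕ | ∃ S : Set (Fin n → Option Bool),
    (∀ p ∈ S, IsCert f b p ∧ paWidth p ≤ w) ∧
    ∀ x : Fin n → Bool, f x = b → ∃! p, p ∈ S ∧ Consistent x p}

/-- Subcube partition complexity `UC(f) = max{UC_0(f), UC_1(f)}`. -/
noncomputable def UC {n : ℕ} (f : (Fin n → Bool) → Bool) : ℕ :=
  max (UCb f false) (UCb f true)

/-! ### The cheat sheet construction -/

/-- Interpret `g 0, …, g (L-1)` as the binary representation of a number. -/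
def bitsToNat (L : ℕ) (g : ℕ → Bool) : ℕ :=
  ∑ t ∈ Finset.range L, if g t then 2 ^ t else 0

/-- Read position `p` of the cell `Y` (`0` when the cell is empty). -/
def cellBit {m : ℕ} (Y : Fin m → Bool) (p : ℕ) : Bool :=
  if h : p % m < m then Y ⟨p % m, h⟩ else false

/-- Decode the `i`-th partial assignment stored in the cell `Y`: it is given by
`Cf` pairs, each consisting of an index (written in `L` bits) and a value bit. -/
def decodePA (N L Cf : ℕ) {m : ℕ} (Y : Fin m → Bool) (i : ℕ) : Fin N → Option Bool :=
  fun j =>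
    ((List.range Cf).find? (fun t =>
        bitsToNat L (fun s => cellBit Y ((i * Cf + t) * (L + 1) + s)) == (j : ℕ))).map
      (fun t => cellBit Y ((i * Cf + t) * (L + 1) + L))

/-- The cheat sheet version of `f`, on its natural (structured) input domain:
`c` inputs to `f` together with `2^c` cells of `m` bits each. -/
noncomputable def cheatSheetAux {N : ℕ} (f : (Fin N → Bool) → Bool) :
    ((Fin (10 * Nat.clog 2 N) × Fin N) ⊕
      (Fin (2 ^ (10 * Nat.clog 2 N)) × Fin (10 * certCC f * (Nat.clog 2 N) ^ 2)) → Bool)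
    → Bool :=
  fun z =>
    let c := 10 * Nat.clog 2 N
    let x : Fin c → (Fin N → Bool) := fun i j => z (Sum.inl (i, j))
    let ℓb : Fin c → Bool := fun i => f (x i)
    let ℓ : ℕ := ∑ i : Fin c, if ℓb i then 2 ^ (c - 1 - (i : ℕ)) else 0
    let Y : Fin (10 * certCC f * (Nat.clog 2 N) ^ 2) → Bool :=
      fun j => z (Sum.inr (⟨ℓ % 2 ^ c, Nat.mod_lt _ (by positivity)⟩, j))
    decide (∀ i : Fin c,
      Consistent (x i) (decodePA N (Nat.clog 2 N) (certCC f) Y (i : ℕ)) ∧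
      IsCert f (ℓb i) (decodePA N (Nat.clog 2 N) (certCC f) Y (i : ℕ)))

/-- Number of input bits of the cheat sheet version of an `N`-bit function with
certificate complexity `Cf`. -/
def csCard (N Cf : ℕ) : ℕ :=
  10 * Nat.clog 2 N * N + 2 ^ (10 * Nat.clog 2 N) * (10 * Cf * (Nat.clog 2 N) ^ 2)

/-- Relabelling of the structured cheat sheet domain as a set of `csCard N Cf` bits. -/
def csIndex (N Cf : ℕ) :
    (Fin (10 * Nat.clog 2 N) × Fin N) ⊕
      (Fin (2 ^ (10 * Nat.clog 2 N)) × Fin (10 * Cf * (Nat.clog 2 N) ^ 2))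
    ≃ Fin (csCard N Cf) :=
  (Equiv.sumCongr finProdFinEquiv finProdFinEquiv).trans finSumFinEquiv

/-- The cheat sheet version `f_CS` of `f`, as a total Boolean function on
`csCard N (C f)` bits. -/
noncomputable def cheatSheet {N : ℕ} (f : (Fin N → Bool) → Bool) :
    (Fin (csCard N (certCC f)) → Bool) → Bool :=
  fun z => cheatSheetAux f (fun u => z (csIndex N (certCC f) u))

/-- If every `1`-input `z` comes with a query set `D z` of size at most `w` such that inputs
agreeing with `z` on `D z` are `1`-inputs with the same query set, then `UC_1(f) ≤ w`. -/
theorem UCb_true_le_of_query {n w : ℕ} {f : (Fin n → Bool) → Bool}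
    (D : (Fin n → Bool) → Finset (Fin n)) (hcard : ∀ z, (D z).card ≤ w)
    (hD : ∀ z z', f z = true → (∀ u ∈ D z, z' u = z u) → f z' = true ∧ D z' = D z) :
    UCb f true ≤ w := by
  let P : (Fin n → Bool) → Fin n → Option Bool :=
    fun z u => if u ∈ D z then some (z u) else none
  have hP : ∀ z z', Consistent z' (P z) ↔ ∀ u ∈ D z, z' u = z u := by
    intro z z'
    refine forall_congr' fun u => ?_
    by_cases hu : u ∈ D z <;> simp [P, hu]
  refine Nat.sInf_le ⟨{p | ∃ z, f z = true ∧ p = P z}, ?_, ?_⟩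
  · rintro _ ⟨z, hz, rfl⟩
    refine ⟨fun z' hz' => (hD z z' hz ((hP z z').1 hz')).1, le_trans ?_ (hcard z)⟩
    refine Finset.card_le_card fun u hu => ?_
    by_contra h
    simp [P, h] at hu
  · intro z hz
    refine ⟨P z, ⟨⟨z, hz, rfl⟩, (hP z z).2 fun _ _ => rfl⟩, ?_⟩
    rintro _ ⟨⟨z', hz', rfl⟩, hcon⟩
    have hagree := (hP z' z).1 hcon
    have hDeq := (hD z' z hz' hagree).2
    funext u
    by_cases hu : u ∈ D z'
    · simp [P, hDeq, hu, hagree u hu]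
    · simp [P, hDeq, hu]

theorem paWidth_decodePA_le (N L Cf : ℕ) {m : ℕ} (Y : Fin m → Bool) (i : ℕ) :
    paWidth (decodePA N L Cf Y i) ≤ Cf := by
  let g : ℕ → ℕ := fun t => bitsToNat L (fun s => cellBit Y ((i * Cf + t) * (L + 1) + s))
  calc paWidth (decodePA N L Cf Y i)
      = ((Finset.univ.filter fun j => (decodePA N L Cf Y i j).isSome).map
          Fin.valEmbedding).card := (Finset.card_map _).symm
    _ ≤ ((Finset.range Cf).image g).card := by
        refine Finset.card_le_card fun k hk => ?_
        obtain ⟨j, hj, rfl⟩ := Finset.mem_map.1 hk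
        have hsome := (Finset.mem_filter.1 hj).2
        simp only [decodePA, Option.isSome_map, List.find?_isSome, List.mem_range,
          beq_iff_eq] at hsome
        obtain ⟨t, ht, hgt⟩ := hsome
        exact Finset.mem_image.2 ⟨t, Finset.mem_range.2 ht, hgt⟩
    _ ≤ Cf := Finset.card_image_le.trans_eq (Finset.card_range Cf)

/-- The structured input positions of the cheat sheet version of an `N`-bit function. -/
abbrev CSPosition (N Cf : ℕ) : Type :=
  (Fin (10 * Nat.clog 2 N) × Fin N) ⊕
    (Fin (2 ^ (10 * Nat.clog 2 N)) × Fin (10 * Cf * (Nat.clog 2 N) ^ 2))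

/-- The cell number selected by a sequence of output bits. -/
def cellOfBits {c : ℕ} (b : Fin c → Bool) : Fin (2 ^ c) :=
  ⟨(∑ i : Fin c, if b i then 2 ^ (c - 1 - (i : ℕ)) else 0) % 2 ^ c,
    Nat.mod_lt _ (by positivity)⟩

/-- The cell number selected by a cheat sheet input. -/
def csLabel {N : ℕ} (f : (Fin N → Bool) → Bool) (y : CSPosition N (certCC f) → Bool) :
    Fin (2 ^ (10 * Nat.clog 2 N)) :=
  cellOfBits fun i => f fun j => y (Sum.inl (i, j))

/-- The `i`-th partial assignment encoded in the selected cell of a cheat sheet input. -/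
noncomputable def csDecode {N : ℕ} (f : (Fin N → Bool) → Bool)
    (y : CSPosition N (certCC f) → Bool) (i : ℕ) : Fin N → Option Bool :=
  decodePA N (Nat.clog 2 N) (certCC f) (fun j => y (Sum.inr (csLabel f y, j))) i

theorem cheatSheetAux_eq_true_iff {N : ℕ} (f : (Fin N → Bool) → Bool)
    (y : CSPosition N (certCC f) → Bool) :
    cheatSheetAux f y = true ↔ ∀ i : Fin (10 * Nat.clog 2 N),
      Consistent (fun j => y (Sum.inl (i, j))) (csDecode f y i) ∧
        IsCert f (f fun j => y (Sum.inl (i, j))) (csDecode f y i) :=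
  decide_eq_true_iff

/-- The positions certifying that a cheat sheet input is accepted: the selected cell, and the
positions fixed by the partial assignments it encodes. -/
noncomputable def csQuery {N : ℕ} (f : (Fin N → Bool) → Bool)
    (y : CSPosition N (certCC f) → Bool) : Finset (CSPosition N (certCC f)) :=
  (Finset.univ.filter fun q : Fin (10 * Nat.clog 2 N) × Fin N =>
    (csDecode f y q.1 q.2).isSome).disjSum ({csLabel f y} ×ˢ Finset.univ)

theorem card_csQuery_le {N : ℕ} (f : (Fin N → Bool) → Bool)
    (y : CSPosition N (certCC f) → Bool) :
    (csQuery f y).card ≤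
      10 * Nat.clog 2 N * certCC f + 10 * certCC f * (Nat.clog 2 N) ^ 2 := by
  rw [csQuery, Finset.card_disjSum, Finset.card_product, Finset.card_singleton,
    Finset.card_univ, Fintype.card_fin, one_mul]
  gcongr
  rw [Finset.card_filter, Fintype.sum_prod_type]
  calc _ ≤ ∑ _i : Fin (10 * Nat.clog 2 N), certCC f := by
        refine Finset.sum_le_sum fun i _ => ?_
        rw [← Finset.card_filter]
        exact paWidth_decodePA_le N (Nat.clog 2 N) (certCC f) _ i
    _ = _ := by simp

theorem cheatSheetAux_of_agree_csQuery {N : ℕ} (f : (Fin N → Bool) → Bool)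
    (y y' : CSPosition N (certCC f) → Bool) (hy : cheatSheetAux f y = true)
    (h : ∀ u ∈ csQuery f y, y' u = y u) :
    cheatSheetAux f y' = true ∧ csQuery f y' = csQuery f y := by
  rw [cheatSheetAux_eq_true_iff] at hy
  have hcon : ∀ i : Fin (10 * Nat.clog 2 N),
      Consistent (fun j => y' (Sum.inl (i, j))) (csDecode f y i) := by
    intro i j b hb
    have hq : Sum.inl (i, j) ∈ csQuery f y := by simp [csQuery, hb]
    exact (h _ hq).trans ((hy i).1 j b hb)
  have hval : ∀ i : Fin (10 * Nat.clog 2 N),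
      (f fun j => y' (Sum.inl (i, j))) = f fun j => y (Sum.inl (i, j)) :=
    fun i => (hy i).2 _ (hcon i)
  have hlabel : csLabel f y' = csLabel f y := congrArg cellOfBits (funext hval)
  have hcell : (fun j => y' (Sum.inr (csLabel f y', j))) =
      fun j => y (Sum.inr (csLabel f y, j)) := by
    funext j
    rw [hlabel]
    exact h _ (by simp [csQuery])
  have hdecode : csDecode f y' = csDecode f y := by
    funext i
    rw [csDecode, csDecode, hcell]
  refine ⟨(cheatSheetAux_eq_true_iff f y').2 fun i => ?_, ?_⟩
  · rw [hdecode, hval i]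
    exact ⟨hcon i, (hy i).2⟩
  · rw [csQuery, csQuery, hdecode, hlabel]

theorem UCb_cheatSheet_true_le {N : ℕ} (f : (Fin N → Bool) → Bool) :
    UCb (cheatSheet f) true ≤
      10 * Nat.clog 2 N * certCC f + 10 * certCC f * (Nat.clog 2 N) ^ 2 := by
  refine UCb_true_le_of_query
    (fun z => (csQuery f fun u => z (csIndex N (certCC f) u)).map
      (csIndex N (certCC f)).toEmbedding) (fun z => ?_) fun z z' hz hagree => ?_
  · rw [Finset.card_map]
    exact card_csQuery_le f _
  · obtain ⟨h₁, h₂⟩ := cheatSheetAux_of_agree_csQuery f _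
      (fun u => z' (csIndex N (certCC f) u)) hz
      fun u hu => hagree _ (Finset.mem_map_of_mem _ hu)
    exact ⟨h₁, by rw [h₂]⟩

theorem clog_two_le_two_mul_logb {N : ℕ} (hN : 2 ≤ N) :
    (Nat.clog 2 N : ℝ) ≤ 2 * Real.logb 2 N := by
  have hone : 1 ≤ Real.logb 2 N := by
    rw [Real.le_logb_iff_rpow_le (by norm_num) (by positivity), Real.rpow_one]
    exact_mod_cast hN
  have hceil : (Nat.clog 2 N : ℝ) = (⌈Real.logb 2 N⌉₊ : ℝ) := by
    exact_mod_cast (Real.natCeil_logb_natCast 2 N).symm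
  have := Nat.ceil_lt_add_one (zero_le_one.trans hone)
  linarith

theorem stmt16 :
    ∃ a : ℝ, 0 < a ∧ ∀ N : ℕ, 2 ≤ N → ∀ f : (Fin N → Bool) → Bool,
      (UCb (cheatSheet f) true : ℝ) ≤ a * certCC f * Real.logb 2 N ^ 2 := by
  refine ⟨80, by norm_num, fun N hN f => ?_⟩
  have hle : (UCb (cheatSheet f) true : ℝ) ≤
      10 * Nat.clog 2 N * certCC f + 10 * certCC f * (Nat.clog 2 N : ℝ) ^ 2 := by
    exact_mod_cast UCb_cheatSheet_true_le f
  have hone : (1 : ℝ) ≤ Nat.clog 2 N := by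
    exact_mod_cast Nat.clog_pos one_lt_two hN
  calc (UCb (cheatSheet f) true : ℝ)
      ≤ 10 * certCC f * (Nat.clog 2 N + (Nat.clog 2 N : ℝ) ^ 2) := by linarith
    _ ≤ 10 * certCC f * (2 * (Nat.clog 2 N : ℝ) ^ 2) := by
        gcongr
        nlinarith
    _ ≤ 10 * certCC f * (2 * (2 * Real.logb 2 N) ^ 2) := by
        gcongr
        exact clog_two_le_two_mul_logb hN
    _ = 80 * certCC f * Real.logb 2 N ^ 2 := by ring
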